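/- Let s ≥ 0, ν > 0 and ℛ ∈ 𝓜^s_od. Then there exists a unique solution Ψ ∈ 𝓜^{s+1}_od of the homological equation [ν∂_yy, Ψ] + ℛ = 0, given by Ψ = 𝐓(ℛ) := Σ_{j,j'∈ℕ, j≠j'} (1/(ν(j² − j'²)))Π_jℛΠ_{j'}, and the solution operator satisfies |𝐓(ℛ)|_s ≤ |𝐓(ℛ)|_{s+1} ≤ C(s)ν⁻¹|ℛ|_s. -/

import Mathlib

open Complex
open scoped ComplexConjugate

noncomputable section

/-- nonzero Fourier modes -/
abbrev Nz : Type := {j : ℤ // j ≠ 0}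

/-- the space `L²₀(𝕋)` of zero-average functions, identified with `ℓ²` of the nonzero
Fourier modes -/
abbrev L20 : Type := lp (fun _ : Nz => ℂ) 2

/-- bounded operators on `L²₀(𝕋)` -/
abbrev Op : Type := L20 →L[ℂ] L20

/-- the positive mode `j` as an element of `Nz` -/
def pz (a : ℕ+) : Nz := ⟨((a : ℕ) : ℤ), by exact_mod_cast a.ne_zero⟩

/-- the negative mode `-j` as an element of `Nz` -/
def nz (a : ℕ+) : Nz := ⟨-((a : ℕ) : ℤ), neg_ne_zero.mpr (by exact_mod_cast a.ne_zero)⟩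

/-- matrix element `𝒯_j^{j'} = ⟨𝒯[e^{ij'y}], e^{ijy}⟩_{L²}` -/
def matEl (T : Op) (j j' : Nz) : ℂ :=
  (2 * Real.pi) * (T (lp.single 2 j' (1 : ℂ))) j

/-- squared Hilbert–Schmidt norm `‖Π_a 𝒯 Π_b‖²_{2×2}` of the `(a,b)` block -/
def blockHSsq (T : Op) (a b : ℕ+) : ℝ :=
  ‖matEl T (pz a) (pz b)‖ ^ 2 + ‖matEl T (pz a) (nz b)‖ ^ 2
    + ‖matEl T (nz a) (pz b)‖ ^ 2 + ‖matEl T (nz a) (nz b)‖ ^ 2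

/-- the `b`-th column sum `∑_{a} ⟨a-b⟩^{2s} ‖Π_a 𝒯 Π_b‖²_{2×2}` -/
def colSq (s : ℝ) (T : Op) (b : ℕ+) : ℝ :=
  ∑' a : ℕ+, (1 + (((a : ℕ) : ℝ) - ((b : ℕ) : ℝ)) ^ 2) ^ s * blockHSsq T a b

/-- membership in the class `𝓜^s` (finite block decay norm) -/
def MemM (s : ℝ) (T : Op) : Prop :=
  (∀ b : ℕ+, Summable fun a : ℕ+ =>
    (1 + (((a : ℕ) : ℝ) - ((b : ℕ) : ℝ)) ^ 2) ^ s * blockHSsq T a b) ∧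
  BddAbove (Set.range fun b : ℕ+ => colSq s T b)

/-- the block decay norm `|𝒯|_s` -/
def mNorm (s : ℝ) (T : Op) : ℝ := ⨆ b : ℕ+, Real.sqrt (colSq s T b)

/-- the `(a,a)` block of `𝒯` vanishes -/
def blockDiagZero (T : Op) (a : ℕ+) : Prop :=
  matEl T (pz a) (pz a) = 0 ∧ matEl T (pz a) (nz a) = 0
    ∧ matEl T (nz a) (pz a) = 0 ∧ matEl T (nz a) (nz a) = 0

/-- the `(a,b)` block of `𝒯` vanishes -/
def blockZero (T : Op) (a b : ℕ+) : Prop :=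
  matEl T (pz a) (pz b) = 0 ∧ matEl T (pz a) (nz b) = 0
    ∧ matEl T (nz a) (pz b) = 0 ∧ matEl T (nz a) (nz b) = 0

/-- membership in `H^σ₀(𝕋)` -/
def memHsl (σ : ℝ) (x : L20) : Prop :=
  Summable fun j : Nz => (1 + ((j : ℤ) : ℝ) ^ 2) ^ σ * ‖x j‖ ^ 2

/-- the `H^σ₀(𝕋)` norm -/
def HsNorml (σ : ℝ) (x : L20) : ℝ :=
  Real.sqrt ((2 * Real.pi) * ∑' j : Nz, (1 + ((j : ℤ) : ℝ) ^ 2) ^ σ * ‖x j‖ ^ 2)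

/-- Square-summable columns define a bounded operator on `ℓ²` with values in a Banach space. -/
theorem exists_clm_of_summable_sq_columns {ι F : Type*} [DecidableEq ι] [NormedAddCommGroup F]
    [NormedSpace ℂ F] [CompleteSpace F] (c : ι → F) (hc : Summable fun i => ‖c i‖ ^ 2) :
    ∃ T : lp (fun _ : ι => ℂ) 2 →L[ℂ] F, ∀ i, T (lp.single 2 i (1 : ℂ)) = c i := by
  have hx (x : lp (fun _ : ι => ℂ) 2) : Summable fun i => ‖x i‖ ^ (2 : ℝ) := by
    simpa using (lp.memℓp x).summable (by norm_num)
  have hc' : Summable fun i => ‖c i‖ ^ (2 : ℝ) := by simpa using hc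
  have hsn (x : lp (fun _ : ι => ℂ) 2) : Summable fun i => ‖x i • c i‖ := by
    simp_rw [norm_smul]
    exact Real.summable_mul_of_Lp_Lq_of_nonneg Real.HolderConjugate.two_two
      (fun _ => norm_nonneg _) (fun _ => norm_nonneg _) (hx x) hc'
  have hsum (x : lp (fun _ : ι => ℂ) 2) : Summable fun i => x i • c i := (hsn x).of_norm
  let L : lp (fun _ : ι => ℂ) 2 →ₗ[ℂ] F :=
    { toFun := fun x => ∑' i, x i • c i
      map_add' := fun x y => by
        rw [← (hsum x).tsum_add (hsum y)]
        simp [add_smul]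
      map_smul' := fun r x => by
        rw [RingHom.id_apply, ← (hsum x).tsum_const_smul]
        simp [mul_smul] }
  refine ⟨L.mkContinuous ((∑' i, ‖c i‖ ^ (2 : ℝ)) ^ (1 / (2 : ℝ))) fun x => ?_, fun i => ?_⟩
  · have hnorm : ‖x‖ = (∑' i, ‖x i‖ ^ (2 : ℝ)) ^ (1 / (2 : ℝ)) := by
      simpa using lp.norm_eq_tsum_rpow (p := 2) (by norm_num) x
    calc ‖∑' i, x i • c i‖ ≤ ∑' i, ‖x i • c i‖ := norm_tsum_le_tsum_norm (hsn x)
      _ = ∑' i, ‖x i‖ * ‖c i‖ := by simp_rw [norm_smul]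
      _ ≤ _ := Real.inner_le_Lp_mul_Lq_tsum_of_nonneg Real.HolderConjugate.two_two
          (fun _ => norm_nonneg _) (fun _ => norm_nonneg _) (hx x) hc'
      _ = _ := by rw [hnorm, mul_comm]
  · change ∑' k, (lp.single 2 i (1 : ℂ) : lp (fun _ : ι => ℂ) 2) k • c k = c i
    rw [tsum_eq_single i]
    · simp
    · intro k hk
      rw [lp.single_apply_ne _ _ _ hk, zero_smul]

theorem op_ext_of_matEl {S T : Op} (h : ∀ j j', matEl S j j' = matEl T j j') : S = T := by
  refine lp.ext_continuousLinearMap (𝕜 := ℂ) (by norm_num) fun j' => ?_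
  ext j
  have := h j j'
  simpa [matEl, Real.pi_ne_zero] using this

theorem pz_or_nz (j : Nz) : ∃ a : ℕ+, (j = pz a ∨ j = nz a) := by
  refine ⟨⟨(j : ℤ).natAbs, Int.natAbs_pos.2 j.2⟩, ?_⟩
  rcases Int.natAbs_eq (j : ℤ) with h | h
  · exact Or.inl (Subtype.ext h)
  · exact Or.inr (Subtype.ext h)

theorem matEl_eq_zero_of_sq_eq {T : Op} (hT : ∀ a, blockDiagZero T a) {j j' : Nz}
    (h : (j : ℤ) ^ 2 = (j' : ℤ) ^ 2) : matEl T j j' = 0 := by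
  obtain ⟨a, ha⟩ := pz_or_nz j
  obtain ⟨b, hb⟩ := pz_or_nz j'
  have hab : a = b := by
    have : ((a : ℕ) : ℤ) ^ 2 = ((b : ℕ) : ℤ) ^ 2 := by
      rcases ha with rfl | rfl <;> rcases hb with rfl | rfl <;> simpa [pz, nz] using h
    have : (a : ℕ) = b := by
      have := (sq_eq_sq₀ (by positivity) (by positivity)).1 this
      exact_mod_cast this
    exact PNat.eq this
  subst hab
  obtain ⟨h1, h2, h3, h4⟩ := hT a
  rcases ha with rfl | rfl <;> rcases hb with rfl | rfl <;> assumption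

theorem abs_le_abs_sq_sub_sq {m n : ℤ} (h : m ^ 2 ≠ n ^ 2) : |n| ≤ |m ^ 2 - n ^ 2| := by
  have hne : |m| ≠ |n| := fun h' => h (sq_eq_sq_iff_abs_eq_abs _ _ |>.2 h')
  rw [← sq_abs m, ← sq_abs n]
  have hm := abs_nonneg m
  have hn := abs_nonneg n
  generalize |m| = a at *
  generalize |n| = b at *
  have h1 : 1 ≤ |a - b| := Int.one_le_abs (sub_ne_zero.2 hne)
  have h2 : a ^ 2 - b ^ 2 = (a - b) * (a + b) := by ring
  rw [h2, abs_mul, abs_of_nonneg (add_nonneg hm hn)]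
  nlinarith

theorem one_add_sub_sq_le {a b : ℕ+} (h : a ≠ b) :
    1 + (((a : ℕ) : ℝ) - ((b : ℕ) : ℝ)) ^ 2 ≤ (((a : ℕ) : ℝ) ^ 2 - ((b : ℕ) : ℝ) ^ 2) ^ 2 := by
  have ha : 1 ≤ ((a : ℕ) : ℤ) := by exact_mod_cast a.pos
  have hb : 1 ≤ ((b : ℕ) : ℤ) := by exact_mod_cast b.pos
  have hab : ((a : ℕ) : ℤ) - ((b : ℕ) : ℤ) ≠ 0 := sub_ne_zero.2 (by exact_mod_cast h)
  suffices H : 1 + (((a : ℕ) : ℤ) - ((b : ℕ) : ℤ)) ^ 2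
      ≤ (((a : ℕ) : ℤ) ^ 2 - ((b : ℕ) : ℤ) ^ 2) ^ 2 by exact_mod_cast H
  generalize ((a : ℕ) : ℤ) = m at *
  generalize ((b : ℕ) : ℤ) = n at *
  have h1 : 1 ≤ (m - n) ^ 2 := by
    have := sq_pos_of_ne_zero hab
    omega
  have h2 : (m ^ 2 - n ^ 2) ^ 2 = (m - n) ^ 2 * (m + n) ^ 2 := by ring
  have h3 : 2 ≤ (m + n) ^ 2 := by nlinarith
  rw [h2]
  nlinarith

theorem blockHSsq_nonneg (T : Op) (a b : ℕ+) : 0 ≤ blockHSsq T a b := by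
  unfold blockHSsq
  positivity

theorem weight_mul_blockHSsq_nonneg (s : ℝ) (T : Op) (a b : ℕ+) :
    0 ≤ (1 + (((a : ℕ) : ℝ) - ((b : ℕ) : ℝ)) ^ 2) ^ s * blockHSsq T a b :=
  mul_nonneg (by positivity) (blockHSsq_nonneg T a b)

/-- A blockwise bound transfers membership in the decay class and bounds the decay norm. -/
theorem MemM.of_blockwise_le {s s' c : ℝ} {T T' : Op} (hc : 0 ≤ c) (hT : MemM s T)
    (h : ∀ a b : ℕ+, (1 + (((a : ℕ) : ℝ) - ((b : ℕ) : ℝ)) ^ 2) ^ s' * blockHSsq T' a b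
      ≤ c ^ 2 * ((1 + (((a : ℕ) : ℝ) - ((b : ℕ) : ℝ)) ^ 2) ^ s * blockHSsq T a b)) :
    MemM s' T' ∧ mNorm s' T' ≤ c * mNorm s T := by
  have hsum (b : ℕ+) : Summable fun a : ℕ+ =>
      (1 + (((a : ℕ) : ℝ) - ((b : ℕ) : ℝ)) ^ 2) ^ s' * blockHSsq T' a b :=
    Summable.of_nonneg_of_le (fun a => weight_mul_blockHSsq_nonneg s' T' a b) (fun a => h a b)
      ((hT.1 b).mul_left _)
  have hcol (b : ℕ+) : colSq s' T' b ≤ c ^ 2 * colSq s T b := by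
    unfold colSq
    rw [← tsum_mul_left]
    exact (hsum b).tsum_le_tsum (fun a => h a b) ((hT.1 b).mul_left _)
  obtain ⟨M, hM⟩ := hT.2
  have hM' (b : ℕ+) : colSq s T b ≤ M := hM ⟨b, rfl⟩
  refine ⟨⟨hsum, c ^ 2 * M, ?_⟩, ciSup_le fun b => ?_⟩
  · rintro _ ⟨b, rfl⟩
    exact (hcol b).trans (by gcongr; exact hM' b)
  · have hbdd : BddAbove (Set.range fun b : ℕ+ => Real.sqrt (colSq s T b)) := by
      refine ⟨Real.sqrt M, ?_⟩
      rintro _ ⟨b, rfl⟩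
      exact Real.sqrt_le_sqrt (hM' b)
    calc Real.sqrt (colSq s' T' b) ≤ Real.sqrt (c ^ 2 * colSq s T b) := Real.sqrt_le_sqrt (hcol b)
      _ = c * Real.sqrt (colSq s T b) := by
          rw [Real.sqrt_mul (sq_nonneg c), Real.sqrt_sq hc]
      _ ≤ c * mNorm s T := by
          gcongr
          exact le_ciSup hbdd b

theorem summable_inv_sq_nz : Summable fun j : Nz => (((j : ℤ) : ℝ) ^ 2)⁻¹ := by
  have := (Real.summable_one_div_int_pow (p := 2)).2 (by norm_num)
  simpa [Function.comp_def] using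
    this.comp_injective (Subtype.val_injective (p := fun j : ℤ => j ≠ 0))

/-- The solution operator of the homological equation produces a bounded operator. -/
theorem exists_homological_solution {ν : ℝ} (hν : 0 < ν) (R : Op) :
    ∃ Ψ : Op, ∀ j j' : Nz, matEl Ψ j j'
      = matEl R j j' / ((ν : ℂ) * (((j : ℤ) : ℂ) ^ 2 - ((j' : ℤ) : ℂ) ^ 2)) := by
  let v (j' : Nz) : L20 := R (lp.single 2 j' (1 : ℂ))
  have hv (j' : Nz) : ‖v j'‖ ≤ ‖R‖ := by
    have := R.le_opNorm (lp.single 2 j' (1 : ℂ))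
    rwa [lp.norm_single (by norm_num), norm_one, mul_one] at this
  let d (j j' : Nz) : ℂ := (ν : ℂ) * (((j : ℤ) : ℂ) ^ 2 - ((j' : ℤ) : ℂ) ^ 2)
  have hd (j j' : Nz) : ‖v j' j / d j j'‖ ≤ ‖(((ν * |((j' : ℤ) : ℝ)|)⁻¹ : ℝ) : ℂ) * v j' j‖ := by
    rw [div_eq_inv_mul, norm_mul, norm_mul]
    gcongr
    have hj' : 0 < |((j' : ℤ) : ℝ)| := abs_pos.2 (by exact_mod_cast j'.2)
    have hd' : ‖d j j'‖ = ν * |((j : ℤ) : ℝ) ^ 2 - ((j' : ℤ) : ℝ) ^ 2| := by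
      have : d j j' = ((ν * (((j : ℤ) : ℝ) ^ 2 - ((j' : ℤ) : ℝ) ^ 2) : ℝ) : ℂ) := by
        simp [d]
      rw [this, Complex.norm_real, Real.norm_eq_abs, abs_mul, abs_of_pos hν]
    have hK : (0 : ℝ) ≤ (ν * |((j' : ℤ) : ℝ)|)⁻¹ := by positivity
    rw [norm_inv, hd', Complex.norm_real, Real.norm_of_nonneg hK]
    by_cases h : (j : ℤ) ^ 2 = (j' : ℤ) ^ 2
    · have : ((j : ℤ) : ℝ) ^ 2 - ((j' : ℤ) : ℝ) ^ 2 = 0 := sub_eq_zero.2 (by exact_mod_cast h)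
      rw [this, abs_zero, mul_zero, inv_zero]
      positivity
    · have : |((j' : ℤ) : ℝ)| ≤ |((j : ℤ) : ℝ) ^ 2 - ((j' : ℤ) : ℝ) ^ 2| := by
        exact_mod_cast abs_le_abs_sq_sub_sq h
      gcongr
  let w (j' : Nz) : L20 := (((ν * |((j' : ℤ) : ℝ)|)⁻¹ : ℝ) : ℂ) • v j'
  let c (j' : Nz) : L20 := ⟨fun j => v j' j / d j j', (lp.memℓp (w j')).mono' (hd · j')⟩
  have hc (j' : Nz) : ‖c j'‖ ≤ (ν * |((j' : ℤ) : ℝ)|)⁻¹ * ‖R‖ := by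
    calc ‖c j'‖ ≤ ‖w j'‖ := lp.norm_mono (by norm_num) (hd · j')
      _ = (ν * |((j' : ℤ) : ℝ)|)⁻¹ * ‖v j'‖ := by
          rw [norm_smul, Complex.norm_real, Real.norm_eq_abs, abs_of_nonneg (by positivity)]
      _ ≤ _ := by gcongr; exact hv j'
  have hsum : Summable fun j' => ‖c j'‖ ^ 2 := by
    refine Summable.of_nonneg_of_le (fun _ => by positivity) (fun j' => ?_)
      (summable_inv_sq_nz.mul_left ((ν⁻¹ * ‖R‖) ^ 2))
    calc ‖c j'‖ ^ 2 ≤ ((ν * |((j' : ℤ) : ℝ)|)⁻¹ * ‖R‖) ^ 2 := by gcongr; exact hc j'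
      _ = _ := by rw [mul_inv, ← sq_abs ((j' : ℤ) : ℝ)]; ring
  obtain ⟨Ψ, hΨ⟩ := exists_clm_of_summable_sq_columns c hsum
  refine ⟨Ψ, fun j j' => ?_⟩
  unfold matEl
  rw [hΨ, mul_div_assoc]

theorem weight_mul_blockHSsq_le {s ν : ℝ} (hν : 0 < ν) {R Ψ : Op}
    (hΨ : ∀ j j' : Nz, matEl Ψ j j'
      = matEl R j j' / ((ν : ℂ) * (((j : ℤ) : ℂ) ^ 2 - ((j' : ℤ) : ℂ) ^ 2))) (a b : ℕ+) :
    (1 + (((a : ℕ) : ℝ) - ((b : ℕ) : ℝ)) ^ 2) ^ (s + 1) * blockHSsq Ψ a b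
      ≤ ν⁻¹ ^ 2 * ((1 + (((a : ℕ) : ℝ) - ((b : ℕ) : ℝ)) ^ 2) ^ s * blockHSsq R a b) := by
  set e : ℝ := ((a : ℕ) : ℝ) ^ 2 - ((b : ℕ) : ℝ) ^ 2 with he
  have hblock : blockHSsq Ψ a b = ν⁻¹ ^ 2 * (e ^ 2)⁻¹ * blockHSsq R a b := by
    have key (x : ℂ) : ‖x / ((ν : ℂ) * (((a : ℕ) : ℂ) ^ 2 - ((b : ℕ) : ℂ) ^ 2))‖ ^ 2
        = ν⁻¹ ^ 2 * (e ^ 2)⁻¹ * ‖x‖ ^ 2 := by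
      have : (ν : ℂ) * (((a : ℕ) : ℂ) ^ 2 - ((b : ℕ) : ℂ) ^ 2) = ((ν * e : ℝ) : ℂ) := by
        simp [he]
      rw [this, norm_div, Complex.norm_real, div_pow, Real.norm_eq_abs, sq_abs, mul_pow,
        div_eq_mul_inv, mul_inv, inv_pow]
      ring
    simp only [blockHSsq, hΨ, pz, nz, Int.cast_neg, Int.cast_natCast, neg_sq, key]
    ring
  have hw : (0 : ℝ) < 1 + (((a : ℕ) : ℝ) - ((b : ℕ) : ℝ)) ^ 2 := by positivity
  have hle : (1 + (((a : ℕ) : ℝ) - ((b : ℕ) : ℝ)) ^ 2) * (e ^ 2)⁻¹ ≤ 1 := by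
    by_cases hab : a = b
    · simp [he, hab]
    · have := one_add_sub_sq_le hab
      exact mul_inv_le_one_of_le₀ this (sq_nonneg e)
  rw [hblock, Real.rpow_add_one hw.ne']
  have hR := weight_mul_blockHSsq_nonneg s R a b
  calc _ = ((1 + (((a : ℕ) : ℝ) - ((b : ℕ) : ℝ)) ^ 2) * (e ^ 2)⁻¹) * (ν⁻¹ ^ 2 *
        ((1 + (((a : ℕ) : ℝ) - ((b : ℕ) : ℝ)) ^ 2) ^ s * blockHSsq R a b)) := by ring
    _ ≤ _ := mul_le_of_le_one_left (by positivity) hle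

theorem mNorm_le_mNorm_add_one {s : ℝ} {T : Op} (hT : MemM (s + 1) T) :
    mNorm s T ≤ mNorm (s + 1) T := by
  have := (hT.of_blockwise_le (s' := s) (T' := T) zero_le_one fun a b => ?_).2
  · simpa using this
  · rw [one_pow, one_mul]
    have := blockHSsq_nonneg T a b
    gcongr
    · nlinarith [sq_nonneg (((a : ℕ) : ℝ) - ((b : ℕ) : ℝ))]
    · linarith

/-- Lemma 3.8, homological equation: for `ℛ ∈ 𝓜^s_od` the equation
`[ν∂_yy, Ψ] + ℛ = 0` (written on matrix elements, where `ν∂_yy` acts diagonally by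
`-νj²`) has a unique solution `Ψ = 𝐓(ℛ) ∈ 𝓜^{s+1}_od`, given by
`Ψ_j^{j'} = ℛ_j^{j'}/(ν(j² - j'²))` for `j² ≠ j'²`, and
`|𝐓(ℛ)|_s ≤ |𝐓(ℛ)|_{s+1} ≤ C(s)ν⁻¹|ℛ|_s`. -/
theorem statement17 (s : ℝ) (hs : 0 ≤ s) :
    ∃ C : ℝ, 0 < C ∧
      ∀ ν : ℝ, 0 < ν →
      ∀ R : Op, MemM s R → (∀ a : ℕ+, blockDiagZero R a) →
        ∃ Ψ : Op,
          (MemM (s + 1) Ψ ∧ (∀ a : ℕ+, blockDiagZero Ψ a) ∧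
            -- the homological equation `[ν∂_yy, Ψ] + ℛ = 0`:
            (∀ j j' : Nz, (ν : ℂ) * (((j' : ℤ) : ℂ) ^ 2 - ((j : ℤ) : ℂ) ^ 2)
                * matEl Ψ j j' + matEl R j j' = 0)) ∧
          -- explicit formula `Ψ = 𝐓(ℛ)`:
          (∀ j j' : Nz, ((j : ℤ) : ℂ) ^ 2 ≠ ((j' : ℤ) : ℂ) ^ 2 →
              matEl Ψ j j'
                = matEl R j j' / ((ν : ℂ) * (((j : ℤ) : ℂ) ^ 2 - ((j' : ℤ) : ℂ) ^ 2))) ∧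
          -- estimates
          mNorm s Ψ ≤ mNorm (s + 1) Ψ ∧
          mNorm (s + 1) Ψ ≤ C * ν⁻¹ * mNorm s R ∧
          -- uniqueness of the solution in `𝓜^{s+1}_od`
          (∀ Ψ' : Op, MemM (s + 1) Ψ' → (∀ a : ℕ+, blockDiagZero Ψ' a) →
              (∀ j j' : Nz, (ν : ℂ) * (((j' : ℤ) : ℂ) ^ 2 - ((j : ℤ) : ℂ) ^ 2)
                  * matEl Ψ' j j' + matEl R j j' = 0) → Ψ' = Ψ) := by
  refine ⟨1, one_pos, fun ν hν R hR hR0 => ?_⟩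
  obtain ⟨Ψ, hΨ⟩ := exists_homological_solution hν R
  obtain ⟨hmem, hnorm⟩ := hR.of_blockwise_le (inv_nonneg.2 hν.le)
    (weight_mul_blockHSsq_le (s := s) hν hΨ)
  have hdiag : ∀ a, blockDiagZero Ψ a := fun a => by
    obtain ⟨h1, h2, h3, h4⟩ := hR0 a
    simp [blockDiagZero, hΨ, h1, h2, h3, h4]
  have hνC : (ν : ℂ) ≠ 0 := by exact_mod_cast hν.ne'
  refine ⟨Ψ, ⟨hmem, hdiag, fun j j' => ?_⟩, fun j j' _ => hΨ j j', mNorm_le_mNorm_add_one hmem,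
    by simpa using hnorm, fun Ψ' _ hdiag' heq => op_ext_of_matEl fun j j' => ?_⟩
  · by_cases h : (j : ℤ) ^ 2 = (j' : ℤ) ^ 2
    · rw [matEl_eq_zero_of_sq_eq hdiag h, matEl_eq_zero_of_sq_eq hR0 h, mul_zero, add_zero]
    · have h' : ((j : ℤ) : ℂ) ^ 2 - ((j' : ℤ) : ℂ) ^ 2 ≠ 0 := sub_ne_zero.2 (by exact_mod_cast h)
      rw [hΨ]
      field_simp
      ring
  · by_cases h : (j : ℤ) ^ 2 = (j' : ℤ) ^ 2
    · rw [matEl_eq_zero_of_sq_eq hdiag h, matEl_eq_zero_of_sq_eq hdiag' h]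
    · have h' : ((j : ℤ) : ℂ) ^ 2 - ((j' : ℤ) : ℂ) ^ 2 ≠ 0 := sub_ne_zero.2 (by exact_mod_cast h)
      rw [hΨ, eq_div_iff (mul_ne_zero hνC h')]
      linear_combination -heq j j'

end
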